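/- arXiv:2111.02245 — 4 statements merged into one kernel-verified Lean document; each statement's English description precedes it below -/
import Mathlib

section
/- Suppose that for all x, y ∈ ℝ² and i, j ∈ {1,2} the series q^{ij}(x,y) := Σ_{k=1}^∞ σ_k^i(x) σ_k^j(y) converges, that q(x,y) = Q(x−y) for a function Q : ℝ² → ℝ²⊗ℝ² which is twice continuously differentiable with sup_{z∈ℝ²} |∇²Q(z)| < ∞, and that Q(0) = Id. Then C_σ := sup_{x≠y} Σ_{k=1}^∞ |σ_k(x) − σ_k(y)|² / |x−y|² is finite. -/
open MeasureTheory Real Filter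
open scoped RealInnerProductSpace ENNReal

noncomputable section

/-- The plane `ℝ²`. -/
abbrev E2 := EuclideanSpace ℝ (Fin 2)

/-- `(∇K ∗ u)(x) = -(1/(2π)) ∫ (x−y)/|x−y|² u(y) dy` for the Newtonian kernel
`K(x) = -(1/(2π)) log |x|` on `ℝ²`. -/
def gradKconv (u : E2 → ℝ) (x : E2) : E2 :=
  (-(2 * Real.pi)⁻¹) • ∫ y : E2, (u y / ‖x - y‖ ^ 2) • (x - y)

/-- The `i`-th standard basis vector of `ℝ²`. -/
def basisE (i : Fin 2) : E2 := EuclideanSpace.single i 1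
theorem second_diff_bound (Q : E2 → Fin 2 → Fin 2 → ℝ) (hQ2 : ContDiff ℝ 2 Q) (M : ℝ)
    (hM : ∀ z : E2, ‖iteratedFDeriv ℝ 2 Q z‖ ≤ M) (z : E2) :
    ‖(Q z + Q (-z)) - (Q 0 + Q 0)‖ ≤ (2 * M * ‖z‖) * ‖z‖ := by
  have hM0 : 0 ≤ M := (norm_nonneg _).trans (hM 0)
  have hd : Differentiable ℝ Q := hQ2.differentiable (by norm_num)
  have hd1 : ContDiff ℝ 1 (fderiv ℝ Q) := hQ2.fderiv_right (by norm_num)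
  have hdd : Differentiable ℝ (fderiv ℝ Q) := hd1.differentiable (by norm_num)
  have hbd : ∀ w : E2, ‖fderiv ℝ (fderiv ℝ Q) w‖ ≤ M := by
    intro w
    have h1 : ‖iteratedFDeriv ℝ 1 (fderiv ℝ Q) w‖ = ‖iteratedFDeriv ℝ 2 Q w‖ :=
      norm_iteratedFDeriv_fderiv
    rw [norm_iteratedFDeriv_one] at h1
    rw [h1]; exact hM w
  have hlip : ∀ a b : E2, ‖fderiv ℝ Q b - fderiv ℝ Q a‖ ≤ M * ‖b - a‖ := fun a b =>
    Convex.norm_image_sub_le_of_norm_fderiv_le (𝕜 := ℝ) (s := Set.univ)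
      (fun x _ => hdd x) (fun x _ => hbd x) convex_univ (Set.mem_univ a) (Set.mem_univ b)
  have hder : ∀ w : E2, HasFDerivAt (fun w => Q w + Q (-w)) (fderiv ℝ Q w - fderiv ℝ Q (-w)) w := by
    intro w
    have h1 := (hd w).hasFDerivAt
    have h2 := ((hd (-w)).hasFDerivAt).comp w ((hasFDerivAt_id w).neg)
    have h3 := h1.add h2
    refine h3.congr_fderiv ?_
    ext v
    simp [sub_eq_add_neg]
  have hb : ∀ w ∈ Metric.closedBall (0 : E2) ‖z‖,
      ‖fderiv ℝ Q w - fderiv ℝ Q (-w)‖ ≤ 2 * M * ‖z‖ := by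
    intro w hw
    have h := hlip (-w) w
    have h2 : ‖w - -w‖ ≤ 2 * ‖z‖ := by
      have hw' : ‖w‖ ≤ ‖z‖ := by simpa using hw
      calc ‖w - -w‖ ≤ ‖w‖ + ‖-w‖ := norm_sub_le _ _
        _ ≤ 2 * ‖z‖ := by rw [norm_neg]; linarith
    nlinarith
  have := Convex.norm_image_sub_le_of_norm_hasFDerivWithin_le (𝕜 := ℝ)
    (fun x _ => (hder x).hasFDerivWithinAt) hb (convex_closedBall (0 : E2) ‖z‖)
    (x := 0) (y := z) (by simp) (by simp)
  simpa using this

theorem stmt1_hasSum (σ : ℕ → E2 → E2) (Q : E2 → Fin 2 → Fin 2 → ℝ)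
    (hsum : ∀ x y : E2, ∀ i j : Fin 2, Summable (fun k => σ k x i * σ k y j))
    (hq : ∀ x y : E2, ∀ i j : Fin 2, ∑' k, σ k x i * σ k y j = Q (x - y) i j) (x y : E2) :
    HasSum (fun k => ‖σ k x - σ k y‖ ^ 2)
      (∑ i : Fin 2, (Q 0 i i + Q 0 i i - (Q (x - y) i i + Q (-(x - y)) i i))) := by
  have H : ∀ a b : E2, ∀ i : Fin 2, HasSum (fun k => σ k a i * σ k b i) (Q (a - b) i i) := by
    intro a b i
    rw [← hq]; exact (hsum a b i i).hasSum
  have h : ∀ i ∈ (Finset.univ : Finset (Fin 2)), HasSum (fun k => (σ k x i - σ k y i) ^ 2)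
      (Q 0 i i + Q 0 i i - (Q (x - y) i i + Q (-(x - y)) i i)) := by
    intro i _
    have h1 := ((H x x i).add (H y y i)).sub ((H x y i).add (H y x i))
    rw [sub_self, sub_self] at h1
    rw [neg_sub]
    have h2 : (fun k => (σ k x i - σ k y i) ^ 2) = fun k =>
        σ k x i * σ k x i + σ k y i * σ k y i - (σ k x i * σ k y i + σ k y i * σ k x i) := by
      funext k
      ring
    rw [h2]
    exact h1
  have h2 := hasSum_sum h
  convert h2 using 2 with k
  rw [EuclideanSpace.norm_sq_eq]
  simp

/-- If the covariances `q^{ij}(x,y) = Σ_k σ_k^i(x) σ_k^j(y)` converge, depend only on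
`x − y` via a twice continuously differentiable matrix function `Q` with bounded second
derivative and `Q(0) = Id`, then
`C_σ = sup_{x ≠ y} Σ_k |σ_k(x) − σ_k(y)|² / |x−y|²` is finite. -/
theorem stmt1 (σ : ℕ → E2 → E2) (Q : E2 → Fin 2 → Fin 2 → ℝ)
    (hsum : ∀ x y : E2, ∀ i j : Fin 2, Summable (fun k => σ k x i * σ k y j))
    (hq : ∀ x y : E2, ∀ i j : Fin 2, ∑' k, σ k x i * σ k y j = Q (x - y) i j)
    (hQ2 : ContDiff ℝ 2 Q)
    (hQbdd : ∃ M : ℝ, ∀ z : E2, ‖iteratedFDeriv ℝ 2 Q z‖ ≤ M)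
    (hQ0 : ∀ i j : Fin 2, Q 0 i j = if i = j then 1 else 0) :
    (⨆ (x : E2) (y : E2) (_ : x ≠ y),
        ∑' k, (‖σ k x - σ k y‖₊ : ℝ≥0∞) ^ 2 / (‖x - y‖₊ : ℝ≥0∞) ^ 2) < ⊤ := by
  obtain ⟨M, hM⟩ := hQbdd
  refine lt_of_le_of_lt (b := ENNReal.ofReal (4 * M)) ?_ ENNReal.ofReal_lt_top
  refine iSup_le fun x => iSup_le fun y => iSup_le fun hxy => ?_
  have hpos : 0 < ‖x - y‖ := norm_pos_iff.2 (sub_ne_zero.2 hxy)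
  have hS := (stmt1_hasSum σ Q hsum hq x y).div_const (‖x - y‖ ^ 2)
  have hterm : ∀ k, (‖σ k x - σ k y‖₊ : ℝ≥0∞) ^ 2 / (‖x - y‖₊ : ℝ≥0∞) ^ 2
      = ENNReal.ofReal (‖σ k x - σ k y‖ ^ 2 / ‖x - y‖ ^ 2) := by
    intro k
    rw [ENNReal.ofReal_div_of_pos (by positivity), ENNReal.ofReal_pow (norm_nonneg _),
      ENNReal.ofReal_pow (norm_nonneg _), ofReal_norm, ofReal_norm]
    rfl
  simp_rw [hterm]
  rw [← ENNReal.ofReal_tsum_of_nonneg (fun k => by positivity) hS.summable, hS.tsum_eq]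
  refine ENNReal.ofReal_le_ofReal ?_
  rw [div_le_iff₀ (by positivity)]
  have hb := second_diff_bound Q hQ2 M hM (x - y)
  have hi : ∀ i : Fin 2, Q 0 i i + Q 0 i i - (Q (x - y) i i + Q (-(x - y)) i i)
      ≤ (2 * M * ‖x - y‖) * ‖x - y‖ := by
    intro i
    have h1 := (norm_le_pi_norm (((Q (x - y) + Q (-(x - y))) - (Q 0 + Q 0)) i) i).trans
      ((norm_le_pi_norm ((Q (x - y) + Q (-(x - y))) - (Q 0 + Q 0)) i).trans hb)
    have h2 := (neg_le_abs _).trans h1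
    simp only [Pi.sub_apply, Pi.add_apply] at h2
    linarith
  rw [Fin.sum_univ_two]
  have := hi 0
  have := hi 1
  nlinarith
end
end

section
/- Let u : ℝ² → ℝ be measurable with u ∈ L¹(ℝ²) ∩ L∞(ℝ²) and ∬_{ℝ²×ℝ²} |u(x)||u(y)|/|x−y| dx dy < ∞, and let φ : ℝ² → ℝ be twice continuously differentiable with bounded first and second derivatives. Then ∫_{ℝ²} u(x) (∇K ∗ u)(x) · ∇φ(x) dx = −(1/(4π)) ∬_{ℝ²×ℝ²} [ (∇φ(x) − ∇φ(y)) · (x − y) / |x − y|² ] u(x) u(y) dy dx. -/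
open MeasureTheory Real Filter
open scoped RealInnerProductSpace ENNReal

noncomputable section

/-- Symmetrisation of the chemotactic advection term: for `u ∈ L¹ ∩ L∞` with
`∬ |u(x)||u(y)|/|x−y| dx dy < ∞` and `φ` of class `C²` with bounded first and second
derivatives,
`∫ u (∇K∗u)·∇φ = −(1/(4π)) ∬ [(∇φ(x)−∇φ(y))·(x−y)/|x−y|²] u(x) u(y) dy dx`. -/
theorem stmt4 (u : E2 → ℝ) (φ : E2 → ℝ)
    (hu_meas : Measurable u) (hu1 : Integrable u volume)
    (hu_bdd : ∃ M : ℝ, ∀ x, |u x| ≤ M)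
    (hdouble : Integrable
      (fun q : E2 × E2 => |u q.1| * |u q.2| / ‖q.1 - q.2‖) volume)
    (hφ : ContDiff ℝ 2 φ)
    (hφ_bdd : ∃ M : ℝ, ∀ x, ‖fderiv ℝ φ x‖ ≤ M ∧ ‖iteratedFDeriv ℝ 2 φ x‖ ≤ M) :
    ∫ x : E2, u x * ⟪gradKconv u x, gradient φ x⟫
      = -(4 * Real.pi)⁻¹ *
          ∫ x : E2, ∫ y : E2,
            (⟪gradient φ x - gradient φ y, x - y⟫ / ‖x - y‖ ^ 2) * (u x * u y) := by
  obtain ⟨M, hM⟩ := hφ_bdd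
  have hgc : Continuous (gradient φ) := by
    have h1 : Continuous (fderiv ℝ φ) := hφ.continuous_fderiv (by norm_num)
    exact (InnerProductSpace.toDual ℝ E2).symm.continuous.comp h1
  have hgb : ∀ x, ‖gradient φ x‖ ≤ M := by
    intro x
    have h2 : ‖gradient φ x‖ = ‖fderiv ℝ φ x‖ :=
      (InnerProductSpace.toDual ℝ E2).symm.norm_map _
    rw [h2]
    exact (hM x).1
  set F : E2 × E2 → ℝ := fun q =>
    (⟪gradient φ q.1, q.1 - q.2⟫ / ‖q.1 - q.2‖ ^ 2) * (u q.1 * u q.2) with hF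
  have hFi : Integrable F (volume.prod volume) := by
    have hd : Integrable (fun q : E2 × E2 => |u q.1| * |u q.2| / ‖q.1 - q.2‖)
      (volume.prod volume) := hdouble
    refine Integrable.mono' (hd.const_mul M) ?_ ?_
    · have hm1 : Measurable (fun q : E2 × E2 => ⟪gradient φ q.1, q.1 - q.2⟫) :=
        (Continuous.inner (hgc.comp continuous_fst)
          (continuous_fst.sub continuous_snd)).measurable
      have hm2 : Measurable (fun q : E2 × E2 => ‖q.1 - q.2‖ ^ 2) :=
        ((continuous_fst.sub continuous_snd).norm.pow 2).measurable
      exact ((hm1.div hm2).mul ((hu_meas.comp measurable_fst).mul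
        (hu_meas.comp measurable_snd))).aestronglyMeasurable
    · refine Eventually.of_forall fun q => ?_
      simp only [hF, norm_mul, norm_div, norm_pow, Real.norm_eq_abs]
      have hi : |⟪gradient φ q.1, q.1 - q.2⟫| ≤ M * ‖q.1 - q.2‖ :=
        (abs_real_inner_le_norm _ _).trans
          (mul_le_mul_of_nonneg_right (hgb _) (norm_nonneg _))
      rcases eq_or_ne (‖q.1 - q.2‖) 0 with h0 | h0
      · simp [h0]
      · have hp : 0 < ‖q.1 - q.2‖ := lt_of_le_of_ne (norm_nonneg _) (Ne.symm h0)
        have hb : |⟪gradient φ q.1, q.1 - q.2⟫| / |‖q.1 - q.2‖| ^ 2 ≤ M / ‖q.1 - q.2‖ := by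
          rw [abs_of_pos hp, div_le_div_iff₀ (by positivity) hp]
          nlinarith
        calc _ ≤ M / ‖q.1 - q.2‖ * (|u q.1| * |u q.2|) := by gcongr
          _ = _ := by ring
  have hFs : Integrable (fun q : E2 × E2 => F q.swap) (volume.prod volume) := hFi.swap
  have hG : ∫ x : E2, ∫ y : E2,
      (⟪gradient φ x - gradient φ y, x - y⟫ / ‖x - y‖ ^ 2) * (u x * u y)
      = 2 * ∫ x : E2, ∫ y : E2, F (x, y) := by
    have e1 : ∀ x y : E2, (⟪gradient φ x - gradient φ y, x - y⟫ / ‖x - y‖ ^ 2) * (u x * u y)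
        = F (x, y) + F (x, y).swap := by
      intro x y
      simp only [hF, Prod.swap]
      rw [norm_sub_rev y x, inner_sub_left, ← neg_sub x y, inner_neg_right]
      ring
    simp_rw [e1]
    have e2 := integral_integral_add (μ := (volume : Measure E2)) (ν := (volume : Measure E2))
      (f := F) (g := fun q => F q.swap) hFi hFs
    rw [e2, two_mul]
    congr 1
    exact (integral_integral_swap (μ := (volume : Measure E2)) (ν := (volume : Measure E2))
      (f := fun x y => F (x, y)) hFi).symm
  have hL : ∀ᵐ x : E2, u x * ⟪gradKconv u x, gradient φ x⟫
      = -(2 * Real.pi)⁻¹ * ∫ y : E2, F (x, y) := by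
    have hd : Integrable (fun q : E2 × E2 => |u q.1| * |u q.2| / ‖q.1 - q.2‖)
      (volume.prod volume) := hdouble
    filter_upwards [hd.prod_right_ae] with x hx
    rcases eq_or_ne (u x) 0 with h0 | h0
    · simp [hF, h0]
    have hi : Integrable (fun y : E2 => (u y / ‖x - y‖ ^ 2) • (x - y)) := by
      refine Integrable.mono' (hx.const_mul (|u x|⁻¹)) ?_ ?_
      · have hm2 : Measurable (fun y : E2 => ‖x - y‖ ^ 2) :=
          ((continuous_const.sub continuous_id).norm.pow 2).measurable
        exact ((hu_meas.div hm2).smul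
          (continuous_const.sub continuous_id).measurable).aestronglyMeasurable
      · refine Eventually.of_forall fun y => ?_
        have h0' : |u x| ≠ 0 := abs_ne_zero.mpr h0
        simp only [norm_smul, norm_div, norm_pow, Real.norm_eq_abs]
        apply le_of_eq
        rcases eq_or_ne (‖x - y‖) 0 with h1 | h1
        · simp [h1]
        · rw [abs_norm]
          field_simp
    have e3 := integral_inner (𝕜 := ℝ) hi (gradient φ x)
    rw [gradKconv, real_inner_smul_left, real_inner_comm, ← e3, mul_left_comm,
      ← integral_const_mul]
    congr 1
    refine integral_congr_ae (Eventually.of_forall fun y => ?_)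
    simp only [hF, real_inner_smul_right]
    ring
  rw [integral_congr_ae hL, integral_const_mul, hG]
  rw [mul_inv, mul_inv]
  ring
end
end

section
/- Let γ, C, χ > 0 and V₀ > 0 satisfy χ > 8π(1 + γ C V₀), and set T*₂ := [log(χ − 8π) − log(χ − 8π γ C V₀ − 8π)] / (2 γ C). Let T ≥ T*₂ and let f : [0,T] → ℝ be continuous and satisfy f(t) ≤ V₀ + (2 − χ/(4π)) t + 2 γ C ∫₀ᵗ f(s) ds for all t ∈ [0,T]. Then f(T*₂) ≤ 0; in particular f cannot be strictly positive at every point of [0,T]. -/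
open MeasureTheory Real Filter
open scoped RealInnerProductSpace ENNReal

noncomputable section

/-- Deterministic core of the positive-probability blow-up criterion: if
`χ > 8π(1 + γ C V₀)`, `T*₂ = [log(χ−8π) − log(χ−8πγCV₀−8π)]/(2γC)`, `T ≥ T*₂` and a
continuous `f : [0,T] → ℝ` satisfies `f(t) ≤ V₀ + (2 − χ/(4π)) t + 2γC ∫₀ᵗ f`, then
`f(T*₂) ≤ 0`; in particular `f` is not strictly positive on all of `[0,T]`. -/
theorem stmt9 (γ C χ V₀ T : ℝ) (hγ : 0 < γ) (hC : 0 < C) (hχ : 0 < χ) (hV : 0 < V₀)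
    (hcond : 8 * Real.pi * (1 + γ * C * V₀) < χ) (T₂ : ℝ)
    (hT₂ : T₂ = (Real.log (χ - 8 * Real.pi)
        - Real.log (χ - 8 * Real.pi * γ * C * V₀ - 8 * Real.pi)) / (2 * γ * C))
    (hT : T₂ ≤ T) (f : ℝ → ℝ) (hf_cont : ContinuousOn f (Set.Icc 0 T))
    (hf_ineq : ∀ t ∈ Set.Icc (0 : ℝ) T,
      f t ≤ V₀ + (2 - χ / (4 * Real.pi)) * t + 2 * γ * C * ∫ s in (0 : ℝ)..t, f s) :
    f T₂ ≤ 0 ∧ ¬ (∀ t ∈ Set.Icc (0 : ℝ) T, 0 < f t) := by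
  have hpi := Real.pi_pos
  have hk : 0 < 2 * γ * C := by positivity
  have hgcv : 0 < γ * C * V₀ := by positivity
  have hpgcv : 0 < Real.pi * (γ * C * V₀) := by positivity
  have hB : 0 < χ - 8 * Real.pi * γ * C * V₀ - 8 * Real.pi := by nlinarith
  have hA : 0 < χ - 8 * Real.pi := by nlinarith
  have hT0 : 0 ≤ T₂ := by
    rw [hT₂]
    apply div_nonneg _ hk.le
    have := Real.log_le_log hB (show _ ≤ χ - 8 * Real.pi by nlinarith)
    linarith
  have h0T : (0 : ℝ) ≤ T := hT0.trans hT
  have hexp : Real.exp (2 * γ * C * T₂) * (χ - 8 * Real.pi * γ * C * V₀ - 8 * Real.pi)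
      = χ - 8 * Real.pi := by
    have : 2 * γ * C * T₂ = Real.log (χ - 8 * Real.pi)
        - Real.log (χ - 8 * Real.pi * γ * C * V₀ - 8 * Real.pi) := by
      rw [hT₂]; field_simp
    rw [this, Real.exp_sub, Real.exp_log hA, Real.exp_log hB]
    field_simp
  obtain ⟨g, hg, hgf⟩ : ∃ g : ℝ → ℝ, Continuous g ∧ ∀ t ∈ Set.Icc (0 : ℝ) T, g t = f t := by
    refine ⟨Set.IccExtend h0T ((Set.Icc 0 T).restrict f),
      (continuousOn_iff_continuous_restrict.1 hf_cont).Icc_extend', fun t ht => ?_⟩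
    rw [Set.IccExtend_of_mem _ _ ht]; rfl
  have hint : ∀ t ∈ Set.Icc (0 : ℝ) T, ∫ s in (0 : ℝ)..t, f s = ∫ s in (0 : ℝ)..t, g s := by
    intro t ht
    apply intervalIntegral.integral_congr
    intro s hs
    rw [Set.uIcc_of_le ht.1] at hs
    exact (hgf s ⟨hs.1, hs.2.trans ht.2⟩).symm
  set k := 2 * γ * C with hkdef
  set b := χ / (4 * Real.pi) - 2 with hb
  let F : ℝ → ℝ := fun t => ∫ s in (0 : ℝ)..t, g s
  have hF : ∀ t, HasDerivAt F (g t) t := fun t => (hg.integral_hasStrictDerivAt 0 t).hasDerivAt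
  let G : ℝ → ℝ := fun t => Real.exp (-(k * t)) * (V₀ - b * t + k * F t - b / k)
  have hG : ∀ t, HasDerivAt G
      (Real.exp (-(k * t)) * (k * (g t - (V₀ - b * t + k * F t)))) t := by
    intro t
    have h1 : HasDerivAt (fun t => Real.exp (-(k * t))) (Real.exp (-(k * t)) * (-(k * 1))) t :=
      (((hasDerivAt_id t).const_mul k).neg).exp
    have h2 : HasDerivAt (fun t => V₀ - b * t + k * F t - b / k) (-(b * 1) + k * g t) t :=
      ((((hasDerivAt_id t).const_mul b).const_sub V₀).add ((hF t).const_mul k)).sub_const (b / k)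
    refine (h1.mul h2).congr_deriv ?_
    field_simp
    ring
  have hle : ∀ t ∈ Set.Icc (0 : ℝ) T, f t ≤ V₀ - b * t + k * F t := by
    intro t ht
    have h := hf_ineq t ht
    rw [hint t ht] at h
    simp only [F, hb]
    linarith
  have hanti : AntitoneOn G (Set.Icc 0 T) := by
    apply antitoneOn_of_deriv_nonpos (convex_Icc 0 T)
    · exact fun t _ => (hG t).continuousAt.continuousWithinAt
    · exact fun t _ => (hG t).differentiableAt.differentiableWithinAt
    · intro t ht
      have ht := interior_subset ht
      rw [(hG t).deriv, hgf t ht]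
      have := hle t ht
      exact mul_nonpos_of_nonneg_of_nonpos (Real.exp_pos _).le
        (mul_nonpos_of_nonneg_of_nonpos hk.le (by linarith))
  have hmem : T₂ ∈ Set.Icc (0 : ℝ) T := ⟨hT0, hT⟩
  have h := hanti ⟨le_rfl, h0T⟩ hmem hT0
  have hmain : f T₂ ≤ 0 := by
    refine (hle T₂ hmem).trans ?_
    have hF0 : F 0 = 0 := intervalIntegral.integral_same
    simp only [G, hF0, mul_zero, neg_zero, Real.exp_zero, sub_zero, add_zero, one_mul] at h
    have hm := mul_le_mul_of_nonneg_left h (Real.exp_pos (k * T₂)).le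
    rw [← mul_assoc, ← Real.exp_add, add_neg_cancel, Real.exp_zero, one_mul] at hm
    have hfin : Real.exp (k * T₂) * (V₀ - b / k) = - (b / k) := by
      have e1 : V₀ - b / k = -(χ - 8 * Real.pi * γ * C * V₀ - 8 * Real.pi) / (4 * Real.pi * k) := by
        rw [hb, hkdef]; field_simp; ring
      have e2 : b / k = (χ - 8 * Real.pi) / (4 * Real.pi * k) := by
        rw [hb]; field_simp; ring
      rw [e1, e2, ← hexp]; ring
    linarith
  exact ⟨hmain, fun hpos => absurd (hpos T₂ hmem) (not_lt.2 hmain)⟩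
end
end

section
/- Let σ_k : ℝ² → ℝ² (k ≥ 1) be continuously differentiable vector fields with ∇·σ_k = 0, such that Σ_{k=1}^∞ σ_k^i(x) σ_k^j(x) = δ_{ij} for all x ∈ ℝ² and i, j, and such that for all i, j, l the series Σ_{k=1}^∞ ∂_l (σ_k^i σ_k^j) converges locally uniformly on ℝ². Then for every x ∈ ℝ² and every i ∈ {1,2}, Σ_{k=1}^∞ Σ_{j=1}^2 σ_k^j(x) ∂_j σ_k^i(x) = 0, i.e. the series Σ_k (∇σ_k · σ_k)(x) of Stratonovich correction drifts vanishes identically. -/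
open MeasureTheory Real Filter
open scoped RealInnerProductSpace ENNReal

noncomputable section

/-- Vanishing of the Stratonovich correction drift: for `C¹`, divergence-free vector
fields `σ_k` with `Σ_k σ_k^i σ_k^j = δ_{ij}`, where for all `i,j,l` the series
`Σ_k ∂_l(σ_k^i σ_k^j)` converges locally uniformly, one has
`Σ_k Σ_j σ_k^j ∂_j σ_k^i = 0` identically. -/
theorem stmt13 (σ : ℕ → E2 → E2)
    (hσ_C1 : ∀ k, ContDiff ℝ 1 (σ k))
    (hσ_div : ∀ k, ∀ x : E2,
      ∑ i : Fin 2, fderiv ℝ (fun y => σ k y i) x (basisE i) = 0)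
    (hδ_sum : ∀ x : E2, ∀ i j : Fin 2, Summable (fun k => σ k x i * σ k x j))
    (hδ : ∀ x : E2, ∀ i j : Fin 2,
      ∑' k, σ k x i * σ k x j = if i = j then 1 else 0)
    (hloc_unif : ∀ i j l : Fin 2, ∃ g : E2 → ℝ,
      TendstoLocallyUniformly
        (fun n x => ∑ k ∈ Finset.range n,
          fderiv ℝ (fun y => σ k y i * σ k y j) x (basisE l))
        g Filter.atTop) :
    ∀ x : E2, ∀ i : Fin 2,
      ∑' k, ∑ j : Fin 2, σ k x j * fderiv ℝ (fun y => σ k y i) x (basisE j) = 0 := by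
  intro x i
  have hd : ∀ k (i : Fin 2), Differentiable ℝ (fun y => σ k y i) := by
    intro k i
    have h := (hσ_C1 k).differentiable one_ne_zero
    exact (EuclideanSpace.proj (𝕜 := ℝ) i).differentiable.comp h
  -- the limits of the differentiated series vanish
  have hlim : ∀ i j l : Fin 2, Tendsto (fun n => ∑ k ∈ Finset.range n,
      fderiv ℝ (fun y => σ k y i * σ k y j) x (basisE l)) atTop (nhds 0) := by
    intro i j l
    obtain ⟨g, hg⟩ := hloc_unif i j l
    have hγ : ∀ t : ℝ, HasDerivAt (fun t : ℝ => x + t • basisE l) (basisE l) t := by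
      intro t
      simpa using ((hasDerivAt_id t).smul_const (basisE l)).const_add x
    have hγc : Continuous (fun t : ℝ => x + t • basisE l) := by fun_prop
    have hu := hg.comp _ hγc
    have h1 : HasDerivAt (fun _ : ℝ => (if i = j then 1 else 0 : ℝ))
        ((g ∘ fun t : ℝ => x + t • basisE l) 0) 0 := by
      refine hasDerivAt_of_tendstoLocallyUniformlyOn (l := atTop) (s := Set.univ) isOpen_univ
        (f := fun n t => ∑ k ∈ Finset.range n,
          σ k (x + t • basisE l) i * σ k (x + t • basisE l) j)
        (tendstoLocallyUniformlyOn_univ.2 hu) ?_ ?_ (Set.mem_univ _)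
      · refine Eventually.of_forall fun n t _ => ?_
        refine HasDerivAt.fun_sum fun k _ => ?_
        exact (((hd k i).mul (hd k j)) (x + t • basisE l)).hasFDerivAt.comp_hasDerivAt t (hγ t)
      · intro t _
        rw [← hδ (x + t • basisE l) i j]
        exact (hδ_sum _ i j).hasSum.tendsto_sum_nat
    have h2 := h1.unique (hasDerivAt_const 0 _)
    have h3 : g x = 0 := by simpa using h2
    rw [← h3]
    exact (tendstoLocallyUniformlyOn_univ.2 hg).tendsto_at (Set.mem_univ x)
  have hk : ∀ k, ∑ j : Fin 2, σ k x j * fderiv ℝ (fun y => σ k y i) x (basisE j)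
      = ∑ j : Fin 2, fderiv ℝ (fun y => σ k y i * σ k y j) x (basisE j) := by
    intro k
    have h : ∀ j : Fin 2, fderiv ℝ (fun y => σ k y i * σ k y j) x (basisE j)
        = σ k x i * fderiv ℝ (fun y => σ k y j) x (basisE j)
          + σ k x j * fderiv ℝ (fun y => σ k y i) x (basisE j) := by
      intro j
      rw [fderiv_fun_mul (hd k i x) (hd k j x)]
      simp
    simp_rw [h]
    rw [Finset.sum_add_distrib, ← Finset.mul_sum, hσ_div k x]
    simp
  by_cases hs : Summable
      (fun k => ∑ j : Fin 2, σ k x j * fderiv ℝ (fun y => σ k y i) x (basisE j))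
  · refine tendsto_nhds_unique hs.hasSum.tendsto_sum_nat ?_
    simp_rw [hk]
    have h := tendsto_finsetSum (Finset.univ : Finset (Fin 2)) fun j _ => hlim i j j
    simp only [Finset.sum_const_zero] at h
    refine h.congr fun n => ?_
    rw [Finset.sum_comm]
  · exact tsum_eq_zero_of_not_summable hs
end
end
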